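/- arXiv:1102.3390 — 5 statements merged into one kernel-verified Lean document; each statement's English description precedes it below -/
import Mathlib

section
/- (Main lemma, marginal fixing a symbol.) For every 0 ≤ i ≤ d−1 and every α ∈ R, the sum Σ over codewords b ∈ C with b_i = α of ∏_{t ≠ i, 0 ≤ t ≤ d−1} g_t(b_t) equals Σ_{s ∈ R} μ_i(s) · ν_{i+1}(s + α). -/
/-- Forward state metric of the BCJR trellis. -/
noncomputable def mu {R : Type*} [Fintype R] [DecidableEq R] [AddCommGroup R]
    (g : ℕ → R → ℝ) (i : ℕ) (s : R) : ℝ :=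
  ∑ b ∈ Finset.univ.filter (fun b : Fin i → R => ∑ t, b t = s),
    ∏ t, g t.1 (b t)

/-- Backward state metric of the BCJR trellis. -/
noncomputable def nu {R : Type*} [Fintype R] [DecidableEq R] [AddCommGroup R]
    (g : ℕ → R → ℝ) (d i : ℕ) (s : R) : ℝ :=
  ∑ b ∈ Finset.univ.filter (fun b : Fin (d - i) → R => s + ∑ t, b t = 0),
    ∏ t, g (i + t.1) (b t)

theorem nu_eq_of_sub_eq {R : Type*} [Fintype R] [DecidableEq R] [AddCommGroup R]
    (g : ℕ → R → ℝ) {d i k : ℕ} (h : d - i = k) (s : R) :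
    nu g d i s = ∑ c : Fin k → R, if s + ∑ t, c t = 0 then ∏ t, g (i + t.1) (c t) else 0 := by
  subst h
  rw [nu, Finset.sum_filter]

theorem sum_mu_mul {R : Type*} [Fintype R] [DecidableEq R] [AddCommGroup R]
    (g : ℕ → R → ℝ) (i : ℕ) (f : R → ℝ) :
    ∑ s, mu g i s * f s = ∑ a : Fin i → R, (∏ t, g t.1 (a t)) * f (∑ t, a t) := by
  simp only [mu, Finset.sum_filter, Finset.sum_mul, ite_mul, zero_mul]
  rw [Finset.sum_comm]
  simp

/-- A sum over words of length `i + 1 + k` splits into sums over the prefix of length `i`,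
the symbol at position `i`, and the suffix of length `k`. -/
theorem sum_append_snoc {R : Type*} [Fintype R] (i k : ℕ) (f : (Fin (i + 1 + k) → R) → ℝ) :
    ∑ b, f b = ∑ a : Fin i → R, ∑ x : R, ∑ c : Fin k → R,
      f (Fin.append (Fin.snoc a x : Fin (i + 1) → R) c) := by
  rw [← (Fin.appendEquiv (i + 1) k).sum_comp, Fintype.sum_prod_type,
    ← (Fin.snocEquiv fun _ : Fin (i + 1) => R).sum_comp, Fintype.sum_prod_type, Finset.sum_comm]
  rfl

theorem prod_erase_append_snoc {R : Type*} (g : ℕ → R → ℝ) (i k : ℕ)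
    (a : Fin i → R) (x : R) (c : Fin k → R) (h : i < i + 1 + k) :
    ∏ t ∈ Finset.univ.erase (⟨i, h⟩ : Fin (i + 1 + k)),
        g t.1 (Fin.append (Fin.snoc a x : Fin (i + 1) → R) c t)
      = (∏ t, g t.1 (a t)) * ∏ t, g (i + 1 + t.1) (c t) := by
  rw [← Finset.filter_ne', Finset.prod_filter, Fin.prod_univ_add, Fin.prod_univ_castSucc]
  have hne (t : Fin i) : (t : ℕ) ≠ i := t.2.ne
  have hne' (t : Fin k) : i + 1 + (t : ℕ) ≠ i := by omega
  simp [Fin.ext_iff, hne, hne']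

/-- Main lemma, marginal fixing a symbol: for every `0 ≤ i ≤ d - 1` and every `α ∈ R`,
the sum over codewords `b` of the single parity-check code
`C = {b ∈ R^d : b 0 + ⋯ + b (d-1) = 0}` with `b i = α` of
`∏_{t ≠ i} g t (b t)` equals `∑_{s ∈ R} μ_i(s) * ν_{i+1}(s + α)`. -/
theorem marginal_eq_eq_trellis_sum {R : Type*} [Fintype R] [DecidableEq R]
    [AddCommGroup R] (g : ℕ → R → ℝ) (d : ℕ) (hd : 1 ≤ d)
    (i : ℕ) (hi : i ≤ d - 1) (α : R) :
    ∑ b ∈ Finset.univ.filter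
        (fun b : Fin d → R => (∑ t, b t = 0) ∧ b ⟨i, by omega⟩ = α),
      ∏ t ∈ Finset.univ.erase ⟨i, by omega⟩, g t.1 (b t)
    = ∑ s : R, mu g i s * nu g d (i + 1) (s + α) := by
  obtain ⟨k, rfl⟩ : ∃ k, d = i + 1 + k := ⟨d - (i + 1), by omega⟩
  have hpos (a : Fin i → R) (x : R) (c : Fin k → R) (h : i < i + 1 + k) :
      Fin.append (Fin.snoc a x : Fin (i + 1) → R) c ⟨i, h⟩ = x := by
    have : (⟨i, h⟩ : Fin (i + 1 + k)) = Fin.castAdd k (Fin.last i) := rfl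
    rw [this, Fin.append_left, Fin.snoc_last]
  rw [sum_mu_mul, Finset.sum_filter, sum_append_snoc]
  refine Finset.sum_congr rfl fun a _ => ?_
  rw [Finset.sum_comm, nu_eq_of_sub_eq g (Nat.add_sub_cancel_left (i + 1) k), Finset.mul_sum]
  refine Finset.sum_congr rfl fun c _ => ?_
  simp only [hpos, prod_erase_append_snoc, Fin.sum_univ_add, Fin.append_left, Fin.append_right,
    Fin.sum_univ_castSucc, Fin.snoc_castSucc, Fin.snoc_last]
  rw [Finset.sum_eq_single α (fun x _ hx => if_neg fun h => hx h.2) (by simp)]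
  simp
end

section
/- (BCJR trellis correctness for the SPC code.) For every 0 ≤ i ≤ d, the total weight of the single parity-check code satisfies Σ over codewords b ∈ C of ∏_{t=0}^{d−1} g_t(b_t) = Σ_{s ∈ R} μ_i(s) · ν_i(s). -/
/-- BCJR trellis correctness for the single parity-check code: for every `0 ≤ i ≤ d`,
the total weight `∑_{b ∈ C} ∏_{t=0}^{d-1} g t (b t)` of the code
`C = {b ∈ R^d : b 0 + ⋯ + b (d-1) = 0}` equals `∑_{s ∈ R} μ_i(s) * ν_i(s)`. -/
theorem total_weight_eq_trellis_cut {R : Type*} [Fintype R] [DecidableEq R]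
    [AddCommGroup R] (g : ℕ → R → ℝ) (d : ℕ) (hd : 1 ≤ d) (i : ℕ) (hi : i ≤ d) :
    ∑ b ∈ Finset.univ.filter (fun b : Fin d → R => ∑ t, b t = 0),
      ∏ t, g t.1 (b t)
    = ∑ s : R, mu g i s * nu g d i s := by
  obtain ⟨k, rfl⟩ := Nat.exists_eq_add_of_le hi
  have key : ∀ s : R, mu g i s * nu g (i + k) i s =
      ∑ a : Fin i → R, ∑ c : Fin k → R, if ∑ t, a t = s then
        (if s + ∑ t, c t = 0 then (∏ t, g t.1 (a t)) * ∏ t, g (i + t.1) (c t) else 0) else 0 := by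
    intro s
    rw [mu, nu, Nat.add_sub_cancel_left, Finset.sum_filter, Finset.sum_filter,
      Finset.sum_mul_sum]
    refine Finset.sum_congr rfl fun a _ => Finset.sum_congr rfl fun c _ => ?_
    split_ifs <;> simp
  simp_rw [key]
  rw [Finset.sum_filter, ← (Fin.appendEquiv i k).sum_comp, Fintype.sum_prod_type]
  symm
  rw [Finset.sum_comm]
  refine Finset.sum_congr rfl fun a _ => ?_
  rw [Finset.sum_comm]
  refine Finset.sum_congr rfl fun c _ => ?_
  simp [Fin.appendEquiv, Fin.sum_univ_add, Fin.prod_univ_add]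
end

section
/- (Marginal via the alternative forward state metric.) For every 0 ≤ i ≤ d−1 and every α ∈ R, the sum Σ over codewords b ∈ C with b_i ≠ α of ∏_{t=0}^{d−1} g_t(b_t) equals Σ_{s' ∈ R} μ̄_{i+1}(s', α) · ν_{i+1}(s'). -/
/-- Alternative forward state metric: `mubar g i s α` is the metric `μ̄_{i+1}(s, α)`,
i.e. the sum over tuples `(b 0, …, b i) ∈ R^(i+1)` with `b 0 + ⋯ + b i = s` and last
symbol `b i ≠ α` of `∏_{t=0}^{i} g t (b t)`. -/
noncomputable def mubar {R : Type*} [Fintype R] [DecidableEq R] [AddCommGroup R]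
    (g : ℕ → R → ℝ) (i : ℕ) (s α : R) : ℝ :=
  ∑ b ∈ Finset.univ.filter
      (fun b : Fin (i + 1) → R => (∑ t, b t = s) ∧ b (Fin.last i) ≠ α),
    ∏ t, g t.1 (b t)

/-- The backward state metric at stage `m` of a trellis of length `m + k`, as a sum over
`Fin k → R`. -/
theorem nu_add_left {R : Type*} [Fintype R] [DecidableEq R] [AddCommGroup R]
    (g : ℕ → R → ℝ) (m k : ℕ) (s : R) :
    nu g (m + k) m s = ∑ c : Fin k → R,
      if s + ∑ t, c t = 0 then ∏ t, g (m + t.1) (c t) else 0 := by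
  unfold nu
  rw [Nat.add_sub_cancel_left, Finset.sum_filter]

/-- Marginal via the alternative forward state metric: for every `0 ≤ i ≤ d - 1` and
every `α ∈ R`, the sum over codewords `b` of the single parity-check code
`C = {b ∈ R^d : b 0 + ⋯ + b (d-1) = 0}` with `b i ≠ α` of `∏_{t=0}^{d-1} g t (b t)`
equals `∑_{s' ∈ R} μ̄_{i+1}(s', α) * ν_{i+1}(s')`. -/
theorem marginal_ne_eq_mubar_sum {R : Type*} [Fintype R] [DecidableEq R]
    [AddCommGroup R] (g : ℕ → R → ℝ) (d : ℕ) (hd : 1 ≤ d)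
    (i : ℕ) (hi : i ≤ d - 1) (α : R) :
    ∑ b ∈ Finset.univ.filter
        (fun b : Fin d → R => (∑ t, b t = 0) ∧ b ⟨i, by omega⟩ ≠ α),
      ∏ t, g t.1 (b t)
    = ∑ s' : R, mubar g i s' α * nu g d (i + 1) s' := by
  obtain ⟨k, rfl⟩ : ∃ k, d = i + 1 + k := ⟨d - (i + 1), by omega⟩
  have hidx (a : Fin (i + 1) → R) (c : Fin k → R) (h : i < i + 1 + k) :
      Fin.append a c ⟨i, h⟩ = a (Fin.last i) := Fin.append_left a c (Fin.last i)
  have hmubar (s : R) : mubar g i s α = ∑ a : Fin (i + 1) → R,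
      if ∑ t, a t = s then (if a (Fin.last i) ≠ α then ∏ t, g t.1 (a t) else 0) else 0 := by
    rw [mubar, Finset.sum_filter]
    simp only [ite_and]
  simp_rw [nu_add_left, hmubar, Finset.sum_mul, ite_mul, zero_mul]
  rw [Finset.sum_comm, Finset.sum_filter, ← (Fin.appendEquiv (i + 1) k).sum_comp,
    Fintype.sum_prod_type]
  refine Finset.sum_congr rfl fun a _ => ?_
  rw [Finset.sum_ite_eq, if_pos (Finset.mem_univ _)]
  by_cases ha : a (Fin.last i) = α
  · simp [Fin.appendEquiv, hidx, ha]
  · simp [Fin.appendEquiv, hidx, ha, Fin.sum_univ_add, Fin.prod_univ_add, Finset.mul_sum]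
end

section
/- (Min-sum marginal excluding a symbol, κ → ∞ version of the main lemma.) Assume d ≥ 2 and |R| ≥ 2. For every 0 ≤ i ≤ d−1 and every α ∈ R, min over codewords b ∈ C with b_i ≠ α of Σ_{t=0}^{d−1} g_t(b_t) equals min over pairs of states (s, s') ∈ R × R with s' − s ≠ α of ( μ'_i(s) + g_i(s' − s) + ν'_{i+1}(s') ), where both minima are over nonempty sets and values are taken in ℝ ∪ {+∞}. -/
/-- Min-sum forward state metric (values in `ℝ ∪ {+∞}`). -/
noncomputable def muMin {R : Type*} [Fintype R] [DecidableEq R] [AddCommGroup R]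
    (g : ℕ → R → ℝ) (i : ℕ) (s : R) : WithTop ℝ :=
  (Finset.univ.filter (fun b : Fin i → R => ∑ t, b t = s)).inf
    (fun b => ((∑ t, g t.1 (b t) : ℝ) : WithTop ℝ))

/-- Min-sum backward state metric (values in `ℝ ∪ {+∞}`). -/
noncomputable def nuMin {R : Type*} [Fintype R] [DecidableEq R] [AddCommGroup R]
    (g : ℕ → R → ℝ) (d i : ℕ) (s : R) : WithTop ℝ :=
  (Finset.univ.filter (fun b : Fin (d - i) → R => s + ∑ t, b t = 0)).inf
    (fun b => ((∑ t, g (i + t.1) (b t) : ℝ) : WithTop ℝ))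

/-- A sum over `Fin d` splits into the part before `i`, the term at `i`, and the part after `i`. -/
theorem Fin.sum_univ_split_at {M : Type*} [AddCommMonoid M] {d i : ℕ} (hi : i < d)
    (h : Fin d → M) :
    ∑ t, h t = ∑ t : Fin i, h ⟨t.1, t.2.trans hi⟩ + h ⟨i, hi⟩
      + ∑ t : Fin (d - (i + 1)), h ⟨i + 1 + t.1, by omega⟩ := by
  obtain ⟨m, hm⟩ : ∃ m, m = d - (i + 1) := ⟨_, rfl⟩
  obtain rfl : d = i + 1 + m := by omega
  rw [Fin.sum_univ_add, Fin.sum_univ_castSucc]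
  congr 1
  exact Fintype.sum_equiv (finCongr hm) _ _ fun _ => rfl

/-- Any prefix, middle symbol and suffix glue to a word of length `d`. -/
theorem Fin.exists_glue_at {R : Type*} {d i : ℕ} (hi : i < d) (u : Fin i → R) (x : R)
    (v : Fin (d - (i + 1)) → R) :
    ∃ b : Fin d → R, (∀ t : Fin i, b ⟨t.1, t.2.trans hi⟩ = u t) ∧ b ⟨i, hi⟩ = x ∧
      ∀ t : Fin (d - (i + 1)), b ⟨i + 1 + t.1, by omega⟩ = v t := by
  refine ⟨fun n => if h : n.1 < i then u ⟨n.1, h⟩ else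
    if h' : n.1 = i then x else v ⟨n.1 - (i + 1), by omega⟩, ?_, ?_, ?_⟩
  · intro t
    simp
  · simp
  · intro t
    have h₁ : ¬ i + 1 + t.1 < i := by omega
    have h₂ : ¬ i + 1 + t.1 = i := by omega
    simp [h₁, h₂]

/-- A finite infimum in a linear order with top is the top element or is attained. -/
theorem Finset.inf_eq_top_or_exists_mem_eq {ι β : Type*} [LinearOrder β] [OrderTop β]
    (s : Finset ι) (f : ι → β) : s.inf f = ⊤ ∨ ∃ a ∈ s, s.inf f = f a := by
  rcases s.eq_empty_or_nonempty with rfl | hs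
  · exact Or.inl Finset.inf_empty
  · exact Or.inr (s.exists_mem_eq_inf hs f)

/-- Min-sum marginal excluding a symbol (κ → ∞ version of the main lemma): assume
`d ≥ 2` and `|R| ≥ 2`.  For every `0 ≤ i ≤ d - 1` and every `α ∈ R`, the minimum over
codewords `b` of the single parity-check code `C = {b ∈ R^d : b 0 + ⋯ + b (d-1) = 0}`
with `b i ≠ α` of `∑_{t=0}^{d-1} g t (b t)` equals the minimum over pairs of states
`(s, s') ∈ R × R` with `s' - s ≠ α` of `μ'_i(s) + g_i(s' - s) + ν'_{i+1}(s')`;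
both minima are over nonempty sets, with values taken in `ℝ ∪ {+∞}`. -/
theorem minsum_marginal_ne_eq_trellis_inf {R : Type*} [Fintype R] [DecidableEq R]
    [AddCommGroup R] (hR : 2 ≤ Fintype.card R) (g : ℕ → R → ℝ) (d : ℕ) (hd : 2 ≤ d)
    (i : ℕ) (hi : i ≤ d - 1) (α : R) :
    (Finset.univ.filter
        (fun b : Fin d → R => (∑ t, b t = 0) ∧ b ⟨i, by omega⟩ ≠ α)).inf
      (fun b => ((∑ t, g t.1 (b t) : ℝ) : WithTop ℝ))
    = (Finset.univ.filter (fun p : R × R => p.2 - p.1 ≠ α)).inf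
        (fun p => muMin g i p.1 + (g i (p.2 - p.1) : WithTop ℝ)
          + nuMin g d (i + 1) p.2) := by
  have hid : i < d := by omega
  apply le_antisymm
  · refine Finset.le_inf fun p hp => ?_
    have hp' : p.2 - p.1 ≠ α := (Finset.mem_filter.1 hp).2
    unfold muMin nuMin
    rcases Finset.inf_eq_top_or_exists_mem_eq
      (Finset.univ.filter (fun b : Fin i → R => ∑ t, b t = p.1))
      (fun b => ((∑ t, g t.1 (b t) : ℝ) : WithTop ℝ)) with h | ⟨u, hu, h⟩
    · rw [h, WithTop.top_add, WithTop.top_add]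
      exact le_top
    rcases Finset.inf_eq_top_or_exists_mem_eq
      (Finset.univ.filter (fun b : Fin (d - (i + 1)) → R => p.2 + ∑ t, b t = 0))
      (fun b => ((∑ t, g (i + 1 + t.1) (b t) : ℝ) : WithTop ℝ)) with h' | ⟨v, hv, h'⟩
    · rw [h', WithTop.add_top]
      exact le_top
    rw [h, h']
    replace hu := (Finset.mem_filter.1 hu).2
    replace hv := (Finset.mem_filter.1 hv).2
    obtain ⟨b, hbu, hbx, hbv⟩ := Fin.exists_glue_at hid u (p.2 - p.1) v
    have hsum : ∑ t, b t = 0 := by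
      rw [Fin.sum_univ_split_at hid]
      simp only [hbu, hbx, hbv, hu, add_sub_cancel, hv]
    refine (Finset.inf_le
      (Finset.mem_filter.2 ⟨Finset.mem_univ b, hsum, hbx.trans_ne hp'⟩)).trans (le_of_eq ?_)
    rw [Fin.sum_univ_split_at hid, WithTop.coe_add, WithTop.coe_add]
    simp only [hbu, hbx, hbv]
  · refine Finset.le_inf fun b hb => ?_
    obtain ⟨hsum, hne⟩ := (Finset.mem_filter.1 hb).2
    rw [Fin.sum_univ_split_at hid] at hsum
    set s := ∑ t : Fin i, b ⟨t.1, t.2.trans hid⟩ with hs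
    refine (Finset.inf_le (b := (s, s + b ⟨i, hid⟩))
      (Finset.mem_filter.2 ⟨Finset.mem_univ _, by simpa using hne⟩)).trans ?_
    rw [Fin.sum_univ_split_at hid, WithTop.coe_add, WithTop.coe_add]
    simp only [add_sub_cancel_left]
    refine add_le_add (add_le_add ?_ le_rfl) ?_
    · exact Finset.inf_le (s := Finset.univ.filter (fun u : Fin i → R => ∑ t, u t = s))
        (f := fun u => ((∑ t, g t.1 (u t) : ℝ) : WithTop ℝ))
        (b := fun t => b ⟨t.1, t.2.trans hid⟩)
        (Finset.mem_filter.2 ⟨Finset.mem_univ _, hs.symm⟩)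
    · exact Finset.inf_le
        (f := fun v : Fin (d - (i + 1)) → R =>
          ((∑ t, g (i + 1 + t.1) (v t) : ℝ) : WithTop ℝ))
        (b := fun t => b ⟨i + 1 + t.1, by omega⟩)
        (Finset.mem_filter.2 ⟨Finset.mem_univ _, hsum⟩)
end

section
/- (Min-sum marginal fixing a symbol, κ → ∞ version of the main lemma.) Assume d ≥ 2. For every 0 ≤ i ≤ d−1 and every α ∈ R, min over codewords b ∈ C with b_i = α of Σ_{t ≠ i, 0 ≤ t ≤ d−1} g_t(b_t) equals min_{s ∈ R} ( μ'_i(s) + ν'_{i+1}(s + α) ), where both minima are over nonempty sets and values are taken in ℝ ∪ {+∞}. -/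
/-- A sum over `Fin d` splits into the part before `i`, the term at `i` and the part after `i`. -/
theorem sum_fin_eq_prefix_add_term_add_suffix {M : Type*} [AddCommMonoid M] {d i m : ℕ}
    (h : i + 1 + m = d) (f : Fin d → M) :
    ∑ t, f t = (∑ t : Fin i, f ⟨t.1, by omega⟩) + f ⟨i, by omega⟩
      + ∑ t : Fin m, f ⟨i + 1 + t.1, by omega⟩ := by
  subst h
  rw [Fin.sum_univ_add, Fin.sum_univ_castSucc]
  rfl

theorem sum_erase_eq_prefix_add_suffix {M : Type*} [AddCommGroup M] {d i m : ℕ}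
    (h : i + 1 + m = d) (f : Fin d → M) :
    ∑ t ∈ Finset.univ.erase ⟨i, by omega⟩, f t = (∑ t : Fin i, f ⟨t.1, by omega⟩)
      + ∑ t : Fin m, f ⟨i + 1 + t.1, by omega⟩ := by
  rw [Finset.sum_erase_eq_sub (Finset.mem_univ _), sum_fin_eq_prefix_add_term_add_suffix h]
  abel

/-- A prefix, a symbol and a suffix can be concatenated to a tuple. -/
theorem exists_fin_concat {R : Type*} {d i m : ℕ} (h : i + 1 + m = d)
    (p : Fin i → R) (a : R) (q : Fin m → R) :
    ∃ b : Fin d → R, (∀ t : Fin i, b ⟨t.1, by omega⟩ = p t) ∧ b ⟨i, by omega⟩ = a ∧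
      ∀ t : Fin m, b ⟨i + 1 + t.1, by omega⟩ = q t := by
  subst h
  refine ⟨Fin.append (Fin.snoc p a : Fin (i + 1) → R) q, fun t => ?_, ?_, fun t => ?_⟩
  · exact (Fin.append_left _ q t.castSucc).trans (Fin.snoc_castSucc (α := fun _ => R) a p t)
  · exact (Fin.append_left _ q (Fin.last i)).trans (Fin.snoc_last (α := fun _ => R) a p)
  · exact Fin.append_right _ q t

/-- Min-sum marginal fixing a symbol (κ → ∞ version of the main lemma): assume
`d ≥ 2`.  For every `0 ≤ i ≤ d - 1` and every `α ∈ R`, the minimum over codewords `b`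
of the single parity-check code `C = {b ∈ R^d : b 0 + ⋯ + b (d-1) = 0}` with `b i = α`
of `∑_{t ≠ i} g t (b t)` equals `min_{s ∈ R} (μ'_i(s) + ν'_{i+1}(s + α))`;
both minima are over nonempty sets, with values taken in `ℝ ∪ {+∞}`. -/
theorem minsum_marginal_eq_eq_trellis_inf {R : Type*} [Fintype R] [DecidableEq R]
    [AddCommGroup R] (g : ℕ → R → ℝ) (d : ℕ) (hd : 2 ≤ d)
    (i : ℕ) (hi : i ≤ d - 1) (α : R) :
    (Finset.univ.filter
        (fun b : Fin d → R => (∑ t, b t = 0) ∧ b ⟨i, by omega⟩ = α)).inf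
      (fun b => ((∑ t ∈ Finset.univ.erase ⟨i, by omega⟩, g t.1 (b t) : ℝ) : WithTop ℝ))
    = Finset.univ.inf (fun s : R => muMin g i s + nuMin g d (i + 1) (s + α)) := by
  have hm : i + 1 + (d - (i + 1)) = d := by omega
  apply le_antisymm
  · refine Finset.le_inf fun s _ => ?_
    unfold muMin nuMin
    rcases Finset.eq_empty_or_nonempty
      (Finset.univ.filter (fun p : Fin i → R => ∑ t, p t = s)) with hp | hp
    · simp [hp]
    rcases Finset.eq_empty_or_nonempty
      (Finset.univ.filter (fun q : Fin (d - (i + 1)) → R => s + α + ∑ t, q t = 0)) with hq | hq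
    · simp [hq]
    obtain ⟨p, hps, hp⟩ := Finset.exists_mem_eq_inf _ hp
      (fun p => ((∑ t, g t.1 (p t) : ℝ) : WithTop ℝ))
    obtain ⟨q, hqs, hq⟩ := Finset.exists_mem_eq_inf _ hq
      (fun q => ((∑ t, g (i + 1 + t.1) (q t) : ℝ) : WithTop ℝ))
    rw [hp, hq]
    obtain ⟨b, hbp, hba, hbq⟩ := exists_fin_concat hm p α q
    have hps := (Finset.mem_filter.mp hps).2
    have hqs := (Finset.mem_filter.mp hqs).2
    refine (Finset.inf_le (b := b) ?_).trans (le_of_eq ?_)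
    · refine Finset.mem_filter.mpr ⟨Finset.mem_univ _, ?_, hba⟩
      rw [sum_fin_eq_prefix_add_term_add_suffix hm]
      simpa only [hbp, hba, hbq, hps] using hqs
    · rw [sum_erase_eq_prefix_add_suffix hm (fun t => g t.1 (b t))]
      simp only [hbp, hbq, WithTop.coe_add]
  · refine Finset.le_inf fun b hb => ?_
    obtain ⟨hb0, hbi⟩ := (Finset.mem_filter.mp hb).2
    rw [sum_fin_eq_prefix_add_term_add_suffix hm, hbi] at hb0
    rw [sum_erase_eq_prefix_add_suffix hm (fun t => g t.1 (b t)), WithTop.coe_add]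
    refine (Finset.inf_le (Finset.mem_univ (∑ t : Fin i, b ⟨t.1, by omega⟩))).trans ?_
    unfold muMin nuMin
    exact add_le_add
      (Finset.inf_le (b := fun t : Fin i => b ⟨t.1, by omega⟩) (by simp))
      (Finset.inf_le (b := fun t : Fin (d - (i + 1)) => b ⟨i + 1 + t.1, by omega⟩)
        (by simpa using hb0))
end
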